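/- arXiv:2306.08497 — 2 statements merged into one kernel-verified Lean document; each statement's English description precedes it below -/
import Mathlib

section
/- Let L > 0, let 0 < l0 < l1 < L, set m = (l0 + l1)/2 and K2 = 4/(l1 − l0)^2, and let K1 > 0. Define β : ℝ → ℝ by β(x) = 1 + K1 * (1 − exp(−K2 * (x − m)^2)). Then the second derivative of β is strictly negative at every point x ∈ [0, L] \ (l0, l1), i.e. β''(x) < 0 for all x ∈ [0, L] with x ∉ (l0, l1). -/
theorem hasDerivAt_exp_neg_mul_sub_sq (K m x : ℝ) :
    HasDerivAt (fun y : ℝ => Real.exp (-K * (y - m) ^ 2))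
      (-(2 * K * (x - m)) * Real.exp (-K * (x - m) ^ 2)) x := by
  convert ((((hasDerivAt_id' x).sub_const m).fun_pow 2).const_mul (-K)).exp using 1
  push_cast
  ring

/-- The second derivative of an inverted Gaussian well. -/
theorem deriv_deriv_one_add_mul_one_sub_exp (C K m x : ℝ) :
    deriv (deriv fun y : ℝ => 1 + C * (1 - Real.exp (-K * (y - m) ^ 2))) x =
      2 * C * K * Real.exp (-K * (x - m) ^ 2) * (1 - 2 * (K * (x - m) ^ 2)) := by
  have hderiv : (deriv fun y : ℝ => 1 + C * (1 - Real.exp (-K * (y - m) ^ 2))) =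
      fun y => 2 * C * K * ((y - m) * Real.exp (-K * (y - m) ^ 2)) := by
    funext y
    rw [((((hasDerivAt_exp_neg_mul_sub_sq K m y).const_sub 1).const_mul C).const_add 1).deriv]
    ring
  rw [hderiv, ((((hasDerivAt_id' x).sub_const m).fun_mul
    (hasDerivAt_exp_neg_mul_sub_sq K m x)).const_mul (2 * C * K)).deriv]
  ring

/-- Outside `(a, b)` the distance to the midpoint is at least half the length. -/
theorem one_le_four_div_mul_sub_midpoint_sq {a b x : ℝ} (hab : a < b) (hx : x ∉ Set.Ioo a b) :
    1 ≤ 4 / (b - a) ^ 2 * (x - (a + b) / 2) ^ 2 := by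
  have hprod : 0 ≤ (x - a) * (x - b) := by
    rcases le_or_gt x a with h | h
    · exact mul_nonneg_of_nonpos_of_nonpos (by linarith) (by linarith)
    · have hbx : b ≤ x := not_lt.mp fun hxb => hx ⟨h, hxb⟩
      exact mul_nonneg (by linarith) (by linarith)
  have hpos : 0 < (b - a) ^ 2 := pow_pos (sub_pos.mpr hab) 2
  rw [div_mul_eq_mul_div, le_div_iff₀ hpos]
  linarith

/-- Property (property-beta-xx) of the spatial Carleman weight: with
`m = (l0+l1)/2` and `K2 = 4/(l1−l0)²`, the second derivative of
`β(x) = 1 + K1(1 − e^{−K2(x−m)²})` is strictly negative on `[0,L] \ (l0,l1)`. -/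
theorem carleman_weight_second_derivative (L l0 l1 K1 : ℝ) (hL : 0 < L)
    (hl0 : 0 < l0) (hl01 : l0 < l1) (hl1L : l1 < L) (hK1 : 0 < K1) :
    let m := (l0 + l1) / 2
    let K2 := 4 / (l1 - l0)^2
    let β : ℝ → ℝ := fun x => 1 + K1 * (1 - Real.exp (-K2 * (x - m)^2))
    ∀ x ∈ Set.Icc (0:ℝ) L, x ∉ Set.Ioo l0 l1 → deriv (deriv β) x < 0 := by
  intro m K2 β x _ hx
  have hK2 : 0 < K2 := div_pos four_pos (pow_pos (sub_pos.mpr hl01) 2)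
  have hfar : 1 ≤ K2 * (x - m) ^ 2 := one_le_four_div_mul_sub_midpoint_sq hl01 hx
  rw [deriv_deriv_one_add_mul_one_sub_exp]
  exact mul_neg_of_pos_of_neg (by positivity) (by linarith)
end

section
/- Let T > 0, K ≥ 1, and define ξ : (0, T) → ℝ by ξ(t) = 1/(t(T − t)). For s > 0 define ρ1(t) = s^(1/2) ξ(t)^(1/2) exp(−s K ξ(t)) and ρ2(t) = s^(1/2) ξ(t)^(−3/2) exp(−s K ξ(t)). Then there exists a constant C > 0, depending only on T and K, such that for every s ≥ 1 and every t ∈ (0, T): ρ2 is differentiable at t and |ρ2'(t)| ≤ C * s * ρ1(t). -/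
/-- The weight `ξ(t) = 1/(t(T−t))` satisfies `ξ' = -(T - 2t) ξ²`. -/
lemma hasDerivAt_one_div_mul_sub {T t : ℝ} (ht : t * (T - t) ≠ 0) :
    HasDerivAt (fun t : ℝ => 1 / (t * (T - t)))
      (-(T - 2 * t) * (1 / (t * (T - t))) ^ 2) t := by
  have h := ((hasDerivAt_id t).mul ((hasDerivAt_id t).const_sub T)).inv ht
  simp only [one_div]
  refine h.congr_deriv ?_
  simp only [id, Pi.mul_apply, inv_pow, div_eq_mul_inv]
  ring

/-- Logarithmic form of the derivative of `c ξ^{-3/2} e^{-aξ}` when `ξ' = -m ξ²`. -/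
lemma HasDerivAt.const_mul_rpow_mul_exp {ξ : ℝ → ℝ} {m t : ℝ} (c a : ℝ) (hpos : 0 < ξ t)
    (hξ : HasDerivAt ξ (-m * ξ t ^ 2) t) :
    HasDerivAt (fun t => c * ξ t ^ (-(3 : ℝ) / 2) * Real.exp (-(a * ξ t)))
      (m * (3 / 2 * (ξ t)⁻¹ + a) * (c * ξ t ^ ((1 : ℝ) / 2) * Real.exp (-(a * ξ t)))) t := by
  have h := ((hξ.rpow_const (p := -(3 : ℝ) / 2) (Or.inl hpos.ne')).const_mul c).mul
    (hξ.const_mul a).neg.exp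
  refine h.congr_deriv ?_
  have e₁ : ξ t ^ (-(3 : ℝ) / 2) = ξ t ^ ((1 : ℝ) / 2) / ξ t ^ 2 := by
    rw [← Real.rpow_natCast, ← Real.rpow_sub hpos]; norm_num
  have e₂ : ξ t ^ (-(3 : ℝ) / 2 - 1) = ξ t ^ ((1 : ℝ) / 2) / ξ t ^ 3 := by
    rw [← Real.rpow_natCast, ← Real.rpow_sub hpos]; norm_num
  simp only [Pi.neg_apply, e₁, e₂]
  field_simp

/-- Derivative bound for the second auxiliary bootstrap weight
`ρ2(t) = s^{1/2} ξ(t)^{−3/2} e^{−sKξ(t)}` with `ξ(t) = 1/(t(T−t))`: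
there is `C = C(T,K) > 0` with `|ρ2'(t)| ≤ C s ρ1(t)` for all `s ≥ 1`,
`t ∈ (0,T)`, where `ρ1(t) = s^{1/2} ξ(t)^{1/2} e^{−sKξ(t)}`. -/
theorem rho2_derivative_bound (T K : ℝ) (hT : 0 < T) (hK : 1 ≤ K) :
    let ξ : ℝ → ℝ := fun t => 1 / (t * (T - t))
    let ρ1 : ℝ → ℝ → ℝ := fun s t =>
      s ^ ((1:ℝ)/2) * (ξ t) ^ ((1:ℝ)/2) * Real.exp (-(s * K * ξ t))
    let ρ2 : ℝ → ℝ → ℝ := fun s t =>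
      s ^ ((1:ℝ)/2) * (ξ t) ^ (-(3:ℝ)/2) * Real.exp (-(s * K * ξ t))
    ∃ C > 0, ∀ s ≥ (1:ℝ), ∀ t ∈ Set.Ioo (0:ℝ) T,
      DifferentiableAt ℝ (ρ2 s) t ∧ |deriv (ρ2 s) t| ≤ C * s * ρ1 s t := by
  intro ξ ρ1 ρ2
  refine ⟨T * (3 / 2 * T ^ 2 + K), by positivity, fun s hs t ⟨ht₀, htT⟩ => ?_⟩
  have hprod : 0 < t * (T - t) := mul_pos ht₀ (sub_pos.mpr htT)
  have hξ : 0 < ξ t := one_div_pos.mpr hprod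
  have hderiv : HasDerivAt (ρ2 s) ((T - 2 * t) * (3 / 2 * (ξ t)⁻¹ + s * K) * ρ1 s t) t :=
    HasDerivAt.const_mul_rpow_mul_exp (s ^ ((1 : ℝ) / 2)) (s * K) hξ
      (hasDerivAt_one_div_mul_sub hprod.ne')
  have hρ1 : 0 ≤ ρ1 s t := by positivity
  have hinv : (ξ t)⁻¹ ≤ T ^ 2 := by
    simp only [ξ, one_div, inv_inv]
    nlinarith
  have hfactor : 3 / 2 * (ξ t)⁻¹ + s * K ≤ (3 / 2 * T ^ 2 + K) * s := by
    nlinarith [sq_nonneg T]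
  have hT' : |T - 2 * t| ≤ T := abs_le.mpr ⟨by linarith, by linarith⟩
  refine ⟨hderiv.differentiableAt, ?_⟩
  have hnonneg : 0 ≤ 3 / 2 * (ξ t)⁻¹ + s * K := by positivity
  rw [hderiv.deriv, abs_mul, abs_mul, abs_of_nonneg hρ1, abs_of_nonneg hnonneg, mul_assoc T]
  gcongr
end
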